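/- There are exactly 138 persistent graphs on 6 vertices. -/

import Mathlib

/-- A graph on the ordered vertex set `Fin n` (representing `{1,…,n}`) is *persistent* if it
contains the Hamilton path `1,…,n`, satisfies the X-property and the bar-property. -/
def IsPersistent {n : ℕ} (G : SimpleGraph (Fin n)) : Prop :=
  (∀ i j : Fin n, (i : ℕ) + 1 = (j : ℕ) → G.Adj i j) ∧
  (∀ a b c d : Fin n, a < b → b < c → c < d → G.Adj a c → G.Adj b d → G.Adj a d) ∧
  (∀ a b : Fin n, (a : ℕ) + 1 < (b : ℕ) → G.Adj a b →
    ∃ x : Fin n, a < x ∧ x < b ∧ G.Adj a x ∧ G.Adj x b)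

/-- The graph on six vertices that contains the path `0, …, 5` and whose other edges are
prescribed by the bits of a vector. -/
def graphOfBits (v : Fin 10 → Bool) : SimpleGraph (Fin 6) :=
  SimpleGraph.fromRel fun i j =>
    ![![false, true, v 0, v 1, v 2, v 3],
      ![false, false, true, v 4, v 5, v 6],
      ![false, false, false, true, v 7, v 8],
      ![false, false, false, false, true, v 9],
      ![false, false, false, false, false, true],
      ![false, false, false, false, false, false]] i j = true

/-- The vector of bits recording which pairs of nonconsecutive vertices are adjacent. -/
noncomputable def bitsOfGraph (G : SimpleGraph (Fin 6)) : Fin 10 → Bool :=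
  open Classical in
  ![decide (G.Adj 0 2), decide (G.Adj 0 3), decide (G.Adj 0 4), decide (G.Adj 0 5),
    decide (G.Adj 1 3), decide (G.Adj 1 4), decide (G.Adj 1 5),
    decide (G.Adj 2 4), decide (G.Adj 2 5), decide (G.Adj 3 5)]

/-- The X-property (the first conjunct) and the bar-property (the second conjunct) of
`graphOfBits v`. -/
def PersistentBits (v : Fin 10 → Bool) : Prop :=
  ((v 0 → v 4 → v 1) ∧ (v 0 → v 5 → v 2) ∧ (v 0 → v 6 → v 3) ∧
    (v 1 → v 5 → v 2) ∧ (v 1 → v 6 → v 3) ∧ (v 2 → v 6 → v 3) ∧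
    (v 1 → v 7 → v 2) ∧ (v 1 → v 8 → v 3) ∧ (v 2 → v 8 → v 3) ∧
    (v 2 → v 9 → v 3) ∧ (v 4 → v 7 → v 5) ∧ (v 4 → v 8 → v 6) ∧
    (v 5 → v 8 → v 6) ∧ (v 5 → v 9 → v 6) ∧ (v 7 → v 9 → v 8)) ∧
  ((v 1 → v 4 ∨ v 0) ∧ (v 2 → v 5 ∨ v 0 ∧ v 7 ∨ v 1) ∧
    (v 3 → v 6 ∨ v 0 ∧ v 8 ∨ v 1 ∧ v 9 ∨ v 2) ∧
    (v 5 → v 7 ∨ v 4) ∧ (v 6 → v 8 ∨ v 4 ∧ v 9 ∨ v 5) ∧ (v 8 → v 9 ∨ v 7))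

set_option synthInstance.maxSize 1024 in
instance : DecidablePred PersistentBits := fun v => by
  unfold PersistentBits
  infer_instance

theorem bitsOfGraph_graphOfBits (v : Fin 10 → Bool) : bitsOfGraph (graphOfBits v) = v := by
  funext i
  fin_cases i <;> simp [bitsOfGraph, graphOfBits]

theorem graphOfBits_bitsOfGraph {G : SimpleGraph (Fin 6)}
    (hG : ∀ i j : Fin 6, (i : ℕ) + 1 = (j : ℕ) → G.Adj i j) :
    graphOfBits (bitsOfGraph G) = G := by
  have h01 := hG 0 1 rfl
  have h12 := hG 1 2 rfl
  have h23 := hG 2 3 rfl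
  have h34 := hG 3 4 rfl
  have h45 := hG 4 5 rfl
  ext i j
  fin_cases i <;> fin_cases j <;>
    simp [bitsOfGraph, graphOfBits, h12, h23, h34, h45, h01.symm, SimpleGraph.adj_comm]

theorem isPersistent_graphOfBits_iff (v : Fin 10 → Bool) :
    IsPersistent (graphOfBits v) ↔ PersistentBits v := by
  simp [IsPersistent, graphOfBits, PersistentBits, Fin.forall_fin_succ, Fin.exists_fin_succ,
    and_assoc]

/-- Persistent graphs on six vertices are the vectors of bits satisfying `PersistentBits`. -/
noncomputable def persistentEquivBits :
    {G : SimpleGraph (Fin 6) // IsPersistent G} ≃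
      {v : Fin 10 → Bool // PersistentBits v} where
  toFun G := ⟨bitsOfGraph G, by
    rw [← isPersistent_graphOfBits_iff, graphOfBits_bitsOfGraph G.2.1]; exact G.2⟩
  invFun v := ⟨graphOfBits v, (isPersistent_graphOfBits_iff v).2 v.2⟩
  left_inv G := Subtype.ext (graphOfBits_bitsOfGraph G.2.1)
  right_inv v := Subtype.ext (bitsOfGraph_graphOfBits v)

/-- there are exactly 138 persistent graphs on 6 vertices. -/
theorem count_persistent_6 : Nat.card {G : SimpleGraph (Fin 6) // IsPersistent G} = 138 := by
  rw [Nat.card_congr persistentEquivBits, Nat.card_eq_fintype_card]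
  decide +kernel
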